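/- L²-error of the centered piecewise-constant projection over a convex partition: Let d ∈ {2, 3}, let Λ ⊂ ℝ^d be a bounded measurable set, and let h > 0. There exists a constant C > 0, depending only on d and Λ (not on h or the partition), with the following property: whenever (K_i)_{i ∈ I} is a finite partition of Λ into pairwise disjoint measurable convex sets with diam K_i ≤ h, points y_i ∈ K_i are chosen for each i ∈ I, u : ℝ^d → ℝ is twice continuously differentiable, and v = Σ_{i ∈ I} u(y_i) · 1_{K_i} is the associated piecewise constant function, then ∫_Λ |u(x) − v(x)|² dx ≤ C · h² · ∫_Λ ( |u(x)|² + ‖∇u(x)‖² + ‖D²u(x)‖² ) dx. -/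

import Mathlib

open MeasureTheory

section CenteredProjection

variable {E : Type*} [NormedAddCommGroup E] [NormedSpace ℝ E]

lemma ContDiff.continuous_sq_norm_fderiv_fderiv {u : E → ℝ} (hu : ContDiff ℝ 2 u) :
    Continuous fun z => ‖fderiv ℝ (fderiv ℝ u) z‖ ^ 2 := by
  have hu1 : ContDiff ℝ 1 (fderiv ℝ u) := hu.fderiv_right (by norm_num)
  exact (hu1.continuous_fderiv (by norm_num)).norm.pow 2

/-- The Cauchy–Schwarz inequality on the unit interval. -/
lemma sq_intervalIntegral_zero_one_le {g : ℝ → ℝ} (hg : Continuous g) :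
    (∫ r in (0 : ℝ)..1, g r) ^ 2 ≤ ∫ r in (0 : ℝ)..1, g r ^ 2 := by
  set c := ∫ r in (0 : ℝ)..1, g r with hc
  have h0 : 0 ≤ ∫ r in (0 : ℝ)..1, (g r - c) ^ 2 :=
    intervalIntegral.integral_nonneg zero_le_one fun r _ => sq_nonneg _
  have h1 : ∫ r in (0 : ℝ)..1, (g r - c) ^ 2
      = ∫ r in (0 : ℝ)..1, ((g r ^ 2 - (2 * c) * g r) + c ^ 2) :=
    intervalIntegral.integral_congr fun r _ => by ring
  rw [h1, intervalIntegral.integral_add, intervalIntegral.integral_sub,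
    intervalIntegral.integral_const_mul, intervalIntegral.integral_const, ← hc] at h0
  · simp only [sub_zero, smul_eq_mul, one_mul] at h0
    nlinarith
  all_goals exact Continuous.intervalIntegrable (by fun_prop) _ _

/-- A first-order Taylor expansion with integral remainder, with the segment from `y` to `x`
parametrised quadratically. -/
lemma sub_sub_fderiv_eq_integral {u : E → ℝ} (hu : ContDiff ℝ 2 u) (x y : E) :
    u x - u y - fderiv ℝ u x (x - y) = ∫ r in (0 : ℝ)..1,
      -(2 * r ^ 3 * fderiv ℝ (fderiv ℝ u) (y + r ^ 2 • (x - y)) (x - y) (x - y)) := by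
  have hu1 : ContDiff ℝ 1 (fderiv ℝ u) := hu.fderiv_right (by norm_num)
  have hu2 : Continuous (fderiv ℝ (fderiv ℝ u)) := hu1.continuous_fderiv (by norm_num)
  set w := x - y with hw
  have hd : ∀ r : ℝ, HasDerivAt (fun r : ℝ => y + r ^ 2 • w) ((2 * r) • w) r := fun r => by
    simpa using ((hasDerivAt_pow 2 r).smul_const w).const_add y
  have hG : ∀ r : ℝ, HasDerivAt
      (fun r : ℝ => u (y + r ^ 2 • w) - r ^ 2 * fderiv ℝ u (y + r ^ 2 • w) w)
      (-(2 * r ^ 3 * fderiv ℝ (fderiv ℝ u) (y + r ^ 2 • w) w w)) r := fun r => by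
    have h1 := ((hu.differentiable (by norm_num)) (y + r ^ 2 • w)).hasFDerivAt.comp_hasDerivAt r
      (hd r)
    have h2 := ((hu1.differentiable (by norm_num)) (y + r ^ 2 • w)).hasFDerivAt.comp_hasDerivAt r
      (hd r)
    have h3 := h1.sub ((hasDerivAt_pow 2 r).mul (h2.clm_apply (hasDerivAt_const r w)))
    refine h3.congr_deriv ?_
    simp
    ring
  rw [intervalIntegral.integral_eq_sub_of_hasDerivAt (fun r _ => hG r)
    (Continuous.intervalIntegrable (by fun_prop) _ _)]
  simp [hw]
  ring

/-- Pointwise control of a difference of values by first and second derivatives. -/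
lemma sq_sub_le_fderiv_add_integral {u : E → ℝ} (hu : ContDiff ℝ 2 u) {x y : E} {D : ℝ}
    (hD : ‖x - y‖ ≤ D) :
    (u x - u y) ^ 2 ≤ 2 * D ^ 2 * ‖fderiv ℝ u x‖ ^ 2 + 8 * D ^ 4 *
      ∫ r in (0 : ℝ)..1, r ^ 6 * ‖fderiv ℝ (fderiv ℝ u) (y + r ^ 2 • (x - y))‖ ^ 2 := by
  have hu1 : ContDiff ℝ 1 (fderiv ℝ u) := hu.fderiv_right (by norm_num)
  have hu2 : Continuous (fderiv ℝ (fderiv ℝ u)) := hu1.continuous_fderiv (by norm_num)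
  have hT := sub_sub_fderiv_eq_integral hu x y
  set w := x - y with hw
  set R := u x - u y - fderiv ℝ u x w with hR
  have hc : Continuous fun r : ℝ => r ^ 6 * ‖fderiv ℝ (fderiv ℝ u) (y + r ^ 2 • w)‖ ^ 2 :=
    (continuous_pow 6).mul (hu.continuous_sq_norm_fderiv_fderiv.comp
      (f := fun r : ℝ => y + r ^ 2 • w) (by fun_prop))
  have hw0 := norm_nonneg w
  have hRsq : R ^ 2 ≤ 4 * D ^ 4 *
      ∫ r in (0 : ℝ)..1, r ^ 6 * ‖fderiv ℝ (fderiv ℝ u) (y + r ^ 2 • w)‖ ^ 2 := by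
    rw [hT, ← intervalIntegral.integral_const_mul]
    refine (sq_intervalIntegral_zero_one_le (by fun_prop)).trans
      (intervalIntegral.integral_mono_on zero_le_one
        (Continuous.intervalIntegrable (by fun_prop) _ _)
        ((hc.const_mul _).intervalIntegrable _ _) fun r _ => ?_)
    have hb := (fderiv ℝ (fderiv ℝ u) (y + r ^ 2 • w)).le_opNorm₂ w w
    set a := fderiv ℝ (fderiv ℝ u) (y + r ^ 2 • w)
    have h2 : (a w w) ^ 2 ≤ (‖a‖ * D ^ 2) ^ 2 := by
      rw [← sq_abs, ← Real.norm_eq_abs]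
      gcongr
      calc ‖a w w‖ ≤ ‖a‖ * ‖w‖ * ‖w‖ := hb
        _ = ‖a‖ * ‖w‖ ^ 2 := by ring
        _ ≤ ‖a‖ * D ^ 2 := by gcongr
    calc (-(2 * r ^ 3 * a w w)) ^ 2 = 4 * r ^ 6 * (a w w) ^ 2 := by ring
      _ ≤ 4 * r ^ 6 * (‖a‖ * D ^ 2) ^ 2 := by gcongr
      _ = _ := by ring
  have hF : (fderiv ℝ u x w) ^ 2 ≤ D ^ 2 * ‖fderiv ℝ u x‖ ^ 2 := by
    rw [← sq_abs, ← Real.norm_eq_abs, ← mul_pow]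
    gcongr
    calc ‖fderiv ℝ u x w‖ ≤ ‖fderiv ℝ u x‖ * ‖w‖ := (fderiv ℝ u x).le_opNorm w
      _ ≤ ‖fderiv ℝ u x‖ * D := by gcongr
      _ = _ := mul_comm _ _
  have hsum : (u x - u y) ^ 2 ≤ 2 * (fderiv ℝ u x w) ^ 2 + 2 * R ^ 2 := by
    have : u x - u y = fderiv ℝ u x w + R := by rw [hR]; ring
    rw [this]
    nlinarith [sq_nonneg (fderiv ℝ u x w - R)]
  linarith

lemma Continuous.integrableOn_of_isBounded {X : Type*} [PseudoMetricSpace X] [T2Space X]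
    [ProperSpace X] [MeasurableSpace X] [OpensMeasurableSpace X] {μ : Measure X}
    [IsFiniteMeasureOnCompacts μ] {f : X → ℝ} (hf : Continuous f) {K : Set X}
    (hK : Bornology.IsBounded K) : IntegrableOn f K μ :=
  (hf.continuousOn.integrableOn_compact hK.isCompact_closure).mono_set subset_closure

variable [FiniteDimensional ℝ E] [MeasurableSpace E] [BorelSpace E]

/-- In dimension at most three, contracting a convex set by `r ^ 2` towards one of its points
increases the integral of a nonnegative function by a factor at most `r⁻⁶`. -/
lemma pow_six_mul_setIntegral_comp_le (μ : Measure E) [μ.IsAddHaarMeasure]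
    (hE : Module.finrank ℝ E ≤ 3) {g : E → ℝ} (hg : Continuous g) (hg0 : ∀ z, 0 ≤ g z)
    {K : Set E} (hKm : MeasurableSet K) (hKc : Convex ℝ K) (hKb : Bornology.IsBounded K)
    {y : E} (hy : y ∈ K) {r : ℝ} (hr : r ∈ Set.Icc (0 : ℝ) 1) :
    ∫ x in K, r ^ 6 * g (y + r ^ 2 • (x - y)) ∂μ ≤ ∫ x in K, g x ∂μ := by
  obtain ⟨hr0, hr1⟩ := hr
  have hI : 0 ≤ ∫ x in K, g x ∂μ := setIntegral_nonneg hKm fun x _ => hg0 x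
  rcases hr0.eq_or_lt with rfl | hr0
  · simpa using hI
  have hint : Integrable (K.indicator g) μ :=
    (integrable_indicator_iff hKm).2 (hg.integrableOn_of_isBounded hKb)
  have hr2 : (r ^ 2 : ℝ) ≠ 0 := by positivity
  have hint' : Integrable (fun x => K.indicator g (y + r ^ 2 • (x - y))) μ :=
    ((hint.comp_add_left y).comp_smul hr2).comp_sub_right y
  rw [integral_const_mul, ← integral_indicator hKm]
  have h1 : ∫ x, K.indicator (fun x => g (y + r ^ 2 • (x - y))) x ∂μ
      ≤ ∫ x, K.indicator g (y + r ^ 2 • (x - y)) ∂μ := by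
    have := FiniteDimensional.proper_real E
    refine integral_mono ((integrable_indicator_iff hKm).2
      (Continuous.integrableOn_of_isBounded (by fun_prop) hKb)) hint' fun x => ?_
    by_cases hx : x ∈ K
    · have hz : y + r ^ 2 • (x - y) ∈ K :=
        hKc.add_smul_sub_mem hy hx ⟨by positivity, pow_le_one₀ hr0.le hr1⟩
      simp [hx, hz]
    · simpa [hx] using Set.indicator_nonneg (fun z _ => hg0 z) _
  have h2 : ∫ x, K.indicator g (y + r ^ 2 • (x - y)) ∂μ
      = ((r ^ 2) ^ Module.finrank ℝ E)⁻¹ * ∫ x in K, g x ∂μ := by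
    rw [integral_sub_right_eq_self (fun x => K.indicator g (y + r ^ 2 • x)) y,
      Measure.integral_comp_smul μ (fun x => K.indicator g (y + x)),
      integral_add_left_eq_self, integral_indicator hKm, smul_eq_mul,
      abs_of_nonneg (by positivity)]
  calc r ^ 6 * ∫ x, K.indicator (fun x => g (y + r ^ 2 • (x - y))) x ∂μ
      ≤ r ^ 6 * (((r ^ 2) ^ Module.finrank ℝ E)⁻¹ * ∫ x in K, g x ∂μ) := by
        rw [← h2]; gcongr
    _ = (r ^ 6 * ((r ^ 2) ^ Module.finrank ℝ E)⁻¹) * ∫ x in K, g x ∂μ := by ring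
    _ ≤ 1 * ∫ x in K, g x ∂μ := by
        gcongr
        rw [← div_eq_mul_inv, div_le_one (by positivity), ← pow_mul]
        exact pow_le_pow_of_le_one hr0.le hr1 (by lia)
    _ = _ := one_mul _

/-- The squared `L²`-distance on a bounded convex set between a `C²` function and one of its values,
with constants depending on the set only through its diameter. -/
lemma setIntegral_sq_sub_le (μ : Measure E) [μ.IsAddHaarMeasure]
    (hE : Module.finrank ℝ E ≤ 3) {u : E → ℝ} (hu : ContDiff ℝ 2 u)
    {K : Set E} (hKm : MeasurableSet K) (hKc : Convex ℝ K) (hKb : Bornology.IsBounded K)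
    {y : E} (hy : y ∈ K) :
    ∫ x in K, (u x - u y) ^ 2 ∂μ ≤
      2 * Metric.diam K ^ 2 * ∫ x in K, ‖fderiv ℝ u x‖ ^ 2 ∂μ +
      8 * Metric.diam K ^ 4 * ∫ x in K, ‖fderiv ℝ (fderiv ℝ u) x‖ ^ 2 ∂μ := by
  have := FiniteDimensional.proper_real E
  have hu0 : Continuous u := hu.continuous
  have hu1 : Continuous (fderiv ℝ u) := hu.continuous_fderiv (by norm_num)
  set N : E → ℝ := fun z => ‖fderiv ℝ (fderiv ℝ u) z‖ ^ 2 with hN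
  have hNc : Continuous N := hu.continuous_sq_norm_fderiv_fderiv
  set F : E → ℝ → ℝ := fun x r => r ^ 6 * N (y + r ^ 2 • (x - y)) with hF
  have hprod : Integrable (Function.uncurry F)
      ((μ.restrict K).prod (volume.restrict (Set.Ioc (0 : ℝ) 1))) := by
    rw [Measure.prod_restrict]
    exact Continuous.integrableOn_of_isBounded (by fun_prop)
      (hKb.prod (Metric.isBounded_Ioc 0 1))
  have hFint : Integrable (fun x => ∫ r in (0 : ℝ)..1, F x r) (μ.restrict K) := by
    simp only [intervalIntegral.integral_of_le zero_le_one]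
    exact hprod.integral_prod_left
  have hFub : ∫ x in K, (∫ r in (0 : ℝ)..1, F x r) ∂μ ≤ ∫ x in K, N x ∂μ := by
    simp only [intervalIntegral.integral_of_le zero_le_one]
    rw [integral_integral_swap hprod]
    calc ∫ r in Set.Ioc (0 : ℝ) 1, ∫ x in K, F x r ∂μ
        ≤ ∫ _ in Set.Ioc (0 : ℝ) 1, ∫ x in K, N x ∂μ :=
          setIntegral_mono_on hprod.integral_prod_right (integrable_const _) measurableSet_Ioc
            fun r hr => pow_six_mul_setIntegral_comp_le μ hE hNc (fun z => by positivity)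
              hKm hKc hKb hy ⟨hr.1.le, hr.2⟩
      _ = _ := by simp
  have hgrad : IntegrableOn (fun x => ‖fderiv ℝ u x‖ ^ 2) K μ :=
    Continuous.integrableOn_of_isBounded (by fun_prop) hKb
  have hbound : IntegrableOn (fun x => 2 * Metric.diam K ^ 2 * ‖fderiv ℝ u x‖ ^ 2
      + 8 * Metric.diam K ^ 4 * ∫ r in (0 : ℝ)..1, F x r) K μ :=
    (hgrad.const_mul _).add (hFint.const_mul _)
  calc ∫ x in K, (u x - u y) ^ 2 ∂μ
      ≤ ∫ x in K, (2 * Metric.diam K ^ 2 * ‖fderiv ℝ u x‖ ^ 2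
          + 8 * Metric.diam K ^ 4 * ∫ r in (0 : ℝ)..1, F x r) ∂μ :=
        setIntegral_mono_on (Continuous.integrableOn_of_isBounded (by fun_prop) hKb)
          hbound hKm fun x hx =>
            sq_sub_le_fderiv_add_integral hu
              (by rw [← dist_eq_norm]; exact Metric.dist_le_diam_of_mem hKb hx hy)
    _ = 2 * Metric.diam K ^ 2 * ∫ x in K, ‖fderiv ℝ u x‖ ^ 2 ∂μ
          + 8 * Metric.diam K ^ 4 * ∫ x in K, (∫ r in (0 : ℝ)..1, F x r) ∂μ := by
        rw [integral_add (hgrad.const_mul _) (hFint.const_mul _), integral_const_mul,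
          integral_const_mul]
    _ ≤ _ := by gcongr

end CenteredProjection

open MeasureTheory

/-- L²-error of the centered piecewise-constant projection over a convex partition. -/
theorem centered_projection_L2_error
    (d : ℕ) (hd : d = 2 ∨ d = 3)
    (Λ : Set (EuclideanSpace ℝ (Fin d)))
    (hΛb : Bornology.IsBounded Λ) (hΛm : MeasurableSet Λ) :
    ∃ C > (0 : ℝ),
      ∀ h : ℝ, 0 < h →
      ∀ (I : Type) (_ : Fintype I) (K : I → Set (EuclideanSpace ℝ (Fin d))),
        (∀ i, MeasurableSet (K i)) →
        (∀ i, Convex ℝ (K i)) →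
        (Pairwise fun i j => Disjoint (K i) (K j)) →
        (⋃ i, K i) = Λ →
        (∀ i, Metric.diam (K i) ≤ h) →
        ∀ y : I → EuclideanSpace ℝ (Fin d), (∀ i, y i ∈ K i) →
        ∀ u : EuclideanSpace ℝ (Fin d) → ℝ, ContDiff ℝ 2 u →
          ∫ x in Λ,
              |u x - ∑ i, Set.indicator (K i) (fun _ => u (y i)) x| ^ 2
            ≤ C * h ^ 2 *
              ∫ x in Λ,
                (|u x| ^ 2 + ‖fderiv ℝ u x‖ ^ 2 + ‖iteratedFDeriv ℝ 2 u x‖ ^ 2) := by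
  refine ⟨2 + 8 * Metric.diam Λ ^ 2, by positivity, ?_⟩
  intro h hh I _ K hKm hKc hKd hKU hKh y hy u hu
  have hu0 : Continuous u := hu.continuous
  have hu1 : Continuous (fderiv ℝ u) := hu.continuous_fderiv (by norm_num)
  have hnorm : ∀ x, ‖iteratedFDeriv ℝ 2 u x‖ = ‖fderiv ℝ (fderiv ℝ u) x‖ := fun x => by
    rw [← norm_iteratedFDeriv_one, norm_iteratedFDeriv_fderiv]
  have hsub : ∀ i, K i ⊆ Λ := fun i => hKU ▸ Set.subset_iUnion K i
  have hKb : ∀ i, Bornology.IsBounded (K i) := fun i => hΛb.subset (hsub i)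
  have hE : Module.finrank ℝ (EuclideanSpace ℝ (Fin d)) ≤ 3 := by
    rw [finrank_euclideanSpace_fin]; lia
  have hval : ∀ i, Set.EqOn
      (fun x => |u x - ∑ j, Set.indicator (K j) (fun _ => u (y j)) x| ^ 2)
      (fun x => (u x - u (y i)) ^ 2) (K i) := fun i x hx => by
    have hsum : ∑ j, Set.indicator (K j) (fun _ => u (y j)) x = u (y i) := by
      rw [Finset.sum_eq_single i]
      · simp [hx]
      · intro j _ hj
        exact Set.indicator_of_notMem (Set.disjoint_right.1 (hKd hj) hx) _
      · simp
    simp only [hsum, sq_abs]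
  have hLint : ∀ i, IntegrableOn
      (fun x => |u x - ∑ j, Set.indicator (K j) (fun _ => u (y j)) x| ^ 2) (K i) := fun i =>
    (Continuous.integrableOn_of_isBounded (by fun_prop) (hKb i)).congr_fun (hval i).symm (hKm i)
  simp only [hnorm]
  have hgrad : ∀ i, IntegrableOn (fun x => ‖fderiv ℝ u x‖ ^ 2) (K i) := fun i =>
    Continuous.integrableOn_of_isBounded (by fun_prop) (hKb i)
  have hhess : ∀ i, IntegrableOn (fun x => ‖fderiv ℝ (fderiv ℝ u) x‖ ^ 2) (K i) := fun i =>
    hu.continuous_sq_norm_fderiv_fderiv.integrableOn_of_isBounded (hKb i)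
  have hfun : ∀ i, IntegrableOn (fun x => |u x| ^ 2) (K i) := fun i =>
    Continuous.integrableOn_of_isBounded (by fun_prop) (hKb i)
  have hRint : ∀ i, IntegrableOn
      (fun x => |u x| ^ 2 + ‖fderiv ℝ u x‖ ^ 2 + ‖fderiv ℝ (fderiv ℝ u) x‖ ^ 2) (K i) := fun i =>
    ((hfun i).add (hgrad i)).add (hhess i)
  rw [← hKU, integral_iUnion_fintype hKm hKd hLint, integral_iUnion_fintype hKm hKd hRint, hKU,
    Finset.mul_sum]
  refine Finset.sum_le_sum fun i _ => ?_
  rw [setIntegral_congr_fun (hKm i) (hval i)]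
  refine (setIntegral_sq_sub_le volume hE hu (hKm i) (hKc i) (hKb i) (hy i)).trans ?_
  have hdiam : Metric.diam (K i) ≤ Metric.diam Λ := Metric.diam_mono (hsub i) hΛb
  have hdiam0 : 0 ≤ Metric.diam (K i) := Metric.diam_nonneg
  have hsplit : ∫ x in K i, (|u x| ^ 2 + ‖fderiv ℝ u x‖ ^ 2 + ‖fderiv ℝ (fderiv ℝ u) x‖ ^ 2)
      = (∫ x in K i, |u x| ^ 2) + (∫ x in K i, ‖fderiv ℝ u x‖ ^ 2)
        + ∫ x in K i, ‖fderiv ℝ (fderiv ℝ u) x‖ ^ 2 := by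
    rw [← integral_add (hfun i) (hgrad i)]
    exact integral_add ((hfun i).add (hgrad i)) (hhess i)
  rw [hsplit]
  have hA : 0 ≤ ∫ x in K i, |u x| ^ 2 := integral_nonneg fun x => by positivity
  have hB : 0 ≤ ∫ x in K i, ‖fderiv ℝ u x‖ ^ 2 := integral_nonneg fun x => by positivity
  have hC : 0 ≤ ∫ x in K i, ‖fderiv ℝ (fderiv ℝ u) x‖ ^ 2 :=
    integral_nonneg fun x => by positivity
  have h1 : 2 * Metric.diam (K i) ^ 2 ≤ (2 + 8 * Metric.diam Λ ^ 2) * h ^ 2 := by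
    gcongr
    · exact le_add_of_nonneg_right (by positivity)
    · exact hKh i
  have h2 : 8 * Metric.diam (K i) ^ 4 ≤ (2 + 8 * Metric.diam Λ ^ 2) * h ^ 2 :=
    calc 8 * Metric.diam (K i) ^ 4 = 8 * Metric.diam (K i) ^ 2 * Metric.diam (K i) ^ 2 := by ring
      _ ≤ 8 * Metric.diam Λ ^ 2 * h ^ 2 := by gcongr; exact hKh i
      _ ≤ _ := by gcongr; exact le_add_of_nonneg_left (by norm_num)
  have h3 : 0 ≤ (2 + 8 * Metric.diam Λ ^ 2) * h ^ 2 := by positivity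
  rw [mul_add, mul_add]
  have := mul_le_mul_of_nonneg_right h1 hB
  have := mul_le_mul_of_nonneg_right h2 hC
  have := mul_nonneg h3 hA
  linarith
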